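/- For every positive natural number n with n ≡ 0 (mod 4), the group cohomology H^n(Σ₃; ℤ) is isomorphic to ℤ/6ℤ. -/

import Mathlib

open CategoryTheory Limits

/-- If `0 ⟶ A ⟶ B ⟶ C ⟶ D` is exact then so is `0 ⟶ A ⟶ B ⟶ ker (C ⟶ D) ⟶ 0`. -/
theorem CategoryTheory.ShortComplex.shortExact_kernelLift {𝒞 : Type*} [Category 𝒞] [Abelian 𝒞]
    {A B C D : 𝒞} (f : A ⟶ B) (g : B ⟶ C) (h : C ⟶ D) [Mono f] (hfg : f ≫ g = 0)
    (hgh : g ≫ h = 0) (hB : (ShortComplex.mk f g hfg).Exact)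
    (hC : (ShortComplex.mk g h hgh).Exact) :
    (ShortComplex.mk f (kernel.lift h g hgh)
      (by simp [← cancel_mono (kernel.ι h), hfg])).ShortExact := by
  have hepi : Epi (kernel.lift h g hgh) := hC.epi_kernelLift
  let φ : ShortComplex.mk f (kernel.lift h g hgh)
      (by simp [← cancel_mono (kernel.ι h), hfg]) ⟶ ShortComplex.mk f g hfg :=
    { τ₁ := 𝟙 _
      τ₂ := 𝟙 _
      τ₃ := kernel.ι h }
  have : Epi φ.τ₁ := inferInstanceAs (Epi (𝟙 A))
  have : IsIso φ.τ₂ := inferInstanceAs (IsIso (𝟙 B))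
  have : Mono φ.τ₃ := inferInstanceAs (Mono (kernel.ι h))
  exact
    { exact := (ShortComplex.exact_iff_of_epi_of_isIso_of_mono φ).2 hB
      mono_f := inferInstanceAs (Mono f)
      epi_g := hepi }

namespace Rep

section FunctionRep

variable (k G V : Type) [CommRing k] [Group G] [AddCommGroup V] [Module k V]

/-- The representation of `G` on functions `G → V` by right translation. -/
noncomputable abbrev functions : Rep k G := Rep.of
  { toFun := fun g => LinearMap.funLeft k V (· * g)
    map_one' := by ext; simp
    map_mul' := fun _ _ => by ext; simp [mul_assoc] : Representation k G (G → V) }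

variable {k G V} in
/-- A linear map between function spaces which commutes with right translations, as a morphism of
representations. -/
noncomputable abbrev functionsHom {W : Type} [AddCommGroup W] [Module k W]
    (T : (G → V) →ₗ[k] (G → W)) (hT : ∀ g f x, T (fun y => f (y * g)) x = T f (x * g)) :
    functions k G V ⟶ functions k G W :=
  Rep.ofHom (T.intertwiningMap_of_isIntertwiningMap _ _ fun g f => funext fun x => hT g f x)

/-- `functions k G V` is coinduced from the trivial subgroup. -/
noncomputable def functionsIsoCoind :
    functions k G V ≅ Rep.coind (⊥ : Subgroup G).subtype (Rep.trivial k (⊥ : Subgroup G) V) :=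
  Rep.mkIso <| Representation.Equiv.mk
    { toFun := fun f => ⟨f, by
        rintro ⟨g, hg⟩ h
        obtain rfl := Subgroup.mem_bot.1 hg
        simp⟩
      invFun := fun f => f.1
      map_add' := fun _ _ => rfl
      map_smul' := fun _ _ => rfl }
    (fun _ => rfl)

theorem isZero_groupCohomology_functions (n : ℕ) :
    IsZero (groupCohomology (functions k G V) (n + 1)) :=
  ((isZero_groupCohomology_succ_of_subsingleton _ n).of_iso
    (groupCohomology.coindIso (Rep.trivial k (⊥ : Subgroup G) V) (n + 1))).of_iso
    ((groupCohomology.functor k G (n + 1)).mapIso (functionsIsoCoind k G V))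

end FunctionRep

theorem exact_of_forall {k G : Type} [CommRing k] [Group G] (S : ShortComplex (Rep k G))
    (h : ∀ x, S.g.hom x = 0 → ∃ y, S.f.hom y = x) : S.Exact := by
  apply (forget₂ _ (ModuleCat k)).reflects_exact_of_faithful
  rw [ShortComplex.moduleCat_exact_iff]
  exact h

end Rep

namespace groupCohomology

variable {k G : Type} [CommRing k] [Group G]

/-- Dimension shifting along a short exact sequence with acyclic middle term. -/
theorem nonempty_iso_succ {X : ShortComplex (Rep k G)} (hX : X.ShortExact)
    (h : ∀ n, IsZero (groupCohomology X.X₂ (n + 1))) (n : ℕ) :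
    Nonempty (groupCohomology X.X₃ (n + 1) ≅ groupCohomology X.X₁ (n + 2)) :=
  have := isIso_δ_of_isZero hX (n + 1) (h n) (h (n + 1))
  ⟨asIso (δ hX (n + 1) (n + 2) rfl)⟩

/-- For a short exact sequence `0 ⟶ X₁ ⟶ X₂ ⟶ X₃ ⟶ 0` with `H¹(G, X₂) = 0`, the group `H¹(G, X₁)`
is the quotient of the invariants of `X₃` by the image of the invariants of `X₂`. -/
theorem exists_surjective_invariants_to_one {X : ShortComplex (Rep k G)} (hX : X.ShortExact)
    (h : IsZero (groupCohomology X.X₂ 1)) :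
    ∃ φ : X.X₃.ρ.invariants →ₗ[k] groupCohomology X.X₁ 1, Function.Surjective φ ∧
      ∀ z, φ z = 0 ↔ ∃ y : X.X₂.ρ.invariants, X.g.hom y.1 = z.1 := by
  have hepi := epi_δ_of_isZero hX 0 h
  refine ⟨((H0Iso X.X₃).inv ≫ δ hX 0 1 rfl).hom,
    (ModuleCat.epi_iff_surjective _).1 (epi_comp _ _), fun z => ?_⟩
  have hnat (a : groupCohomology X.X₂ 0) :
      X.g.hom ((H0Iso X.X₂).hom a).1 =
        ((H0Iso X.X₃).hom (map (MonoidHom.id G) X.g 0 a)).1 := by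
    rw [map_id_comp_H0Iso_hom_apply]
    rfl
  constructor
  · intro hz
    obtain ⟨(a : groupCohomology X.X₂ 0), ha⟩ := (ShortComplex.moduleCat_exact_iff _).1
      (mapShortComplex₃_exact hX (rfl : 0 + 1 = 1)) ((H0Iso X.X₃).inv z) hz
    replace ha : map (MonoidHom.id G) X.g 0 a = (H0Iso X.X₃).inv z := ha
    refine ⟨(H0Iso X.X₂).hom a, ?_⟩
    rw [hnat, ha]
    simp
  · rintro ⟨y, hy⟩
    have hz : (H0Iso X.X₃).inv z = map (MonoidHom.id G) X.g 0 ((H0Iso X.X₂).inv y) := by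
      apply (ModuleCat.mono_iff_injective (H0Iso X.X₃).hom).1 inferInstance
      apply Subtype.ext
      rw [← hnat]
      simpa using hy.symm
    have hc := (mapShortComplex₃ hX (rfl : 0 + 1 = 1)).zero
    change δ hX 0 1 rfl ((H0Iso X.X₃).inv z) = 0
    rw [hz]
    exact ConcreteCategory.congr_hom hc ((H0Iso X.X₂).inv y)

end groupCohomology

namespace SymmetricGroupThree

open Equiv

/-- The symmetric group on three letters. -/
local notation "S₃" => Perm (Fin 3)

/-- The transposition `(0 1)`. -/
local notation "s" => (swap 0 1 : Perm (Fin 3))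

/-- The transposition `(1 2)`. -/
local notation "t" => (swap 1 2 : Perm (Fin 3))

theorem forall_perm_iff (P : S₃ → Prop) :
    (∀ z, P z) ↔ P 1 ∧ P s ∧ P t ∧ P (s * t) ∧ P (t * s) ∧ P (s * t * s) := by
  refine ⟨fun h => ⟨h _, h _, h _, h _, h _, h _⟩, ?_⟩
  rintro ⟨h1, h2, h3, h4, h5, h6⟩ z
  have : z = 1 ∨ z = s ∨ z = t ∨ z = s * t ∨ z = t * s ∨ z = s * t * s := by
    revert z; decide
  rcases this with rfl | rfl | rfl | rfl | rfl | rfl <;> assumption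

theorem exists_fun {V : Type*} (a b c d e f : V) :
    ∃ F : S₃ → V, F 1 = a ∧ F s = b ∧ F t = c ∧ F (s * t) = d ∧ F (t * s) = e ∧
      F (s * t * s) = f := by
  classical
  exact ⟨fun z => if z = 1 then a else if z = s then b else if z = t then c else
    if z = s * t then d else if z = t * s then e else f, by
    refine ⟨?_, ?_, ?_, ?_, ?_, ?_⟩ <;> simp +decide⟩

theorem sum_perm (f : S₃ → ℤ) :
    ∑ z, f z = f 1 + f s + f t + f (s * t) + f (t * s) + f (s * t * s) := by
  have : (Finset.univ : Finset S₃) = {1, s, t, s * t, t * s, s * t * s} := by decide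
  rw [this]
  repeat rw [Finset.sum_insert (by decide)]
  rw [Finset.sum_singleton]
  ring

theorem s_mul_s : s * s = 1 := by decide
theorem t_mul_t : t * t = 1 := by decide
theorem s_mul_s_mul_t : s * (s * t) = t := by decide
theorem s_mul_t_mul_s : s * (t * s) = s * t * s := by decide
theorem s_mul_s_mul_t_mul_s : s * (s * t * s) = t * s := by decide
theorem t_mul_s_mul_t : t * (s * t) = s * t * s := by decide
theorem t_mul_t_mul_s : t * (t * s) = s := by decide
theorem t_mul_s_mul_t_mul_s : t * (s * t * s) = s * t := by decide

/-- The Fox differential of the generators `s` and `t`, as a linear map. -/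
def foxOneLin : (S₃ → ℤ × ℤ) →ₗ[ℤ] (S₃ → ℤ) where
  toFun f z := (f (s * z)).1 - (f z).1 + (f (t * z)).2 - (f z).2
  map_add' f g := by ext; simp; ring
  map_smul' a f := by ext; simp; ring

/-- The Fox differential of the relations `s * t * s = t * s * t` and `s * s = 1`, as a linear
map. -/
def foxTwoLin : (S₃ → ℤ × ℤ) →ₗ[ℤ] (S₃ → ℤ × ℤ) where
  toFun f z := ((f z).1 + (f (s * (t * z))).1 - (f (t * z)).1 + (f z).2 + (f (s * z)).2,
    (f (s * z)).1 - (f z).1 - (f (t * (s * z))).1)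
  map_add' f g := by ext <;> simp <;> ring
  map_smul' a f := by ext <;> simp <;> ring

/-- The differential of the identity among the relations defining `foxTwoLin`, as a linear map. -/
def foxThreeLin : (S₃ → ℤ) →ₗ[ℤ] (S₃ → ℤ × ℤ) where
  toFun f z := (f z + f (s * z) - f (t * (s * z)) - f (s * (t * (s * z))),
    f (t * (s * z)) - f (t * z))
  map_add' f g := by ext <;> simp <;> ring
  map_smul' a f := by ext <;> simp <;> ring

theorem foxOneLin_apply (f : S₃ → ℤ × ℤ) (z : S₃) :
    foxOneLin f z = (f (s * z)).1 - (f z).1 + (f (t * z)).2 - (f z).2 := rfl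

theorem foxTwoLin_apply (f : S₃ → ℤ × ℤ) (z : S₃) :
    foxTwoLin f z = ((f z).1 + (f (s * (t * z))).1 - (f (t * z)).1 + (f z).2 + (f (s * z)).2,
      (f (s * z)).1 - (f z).1 - (f (t * (s * z))).1) := rfl

theorem foxThreeLin_apply (f : S₃ → ℤ) (z : S₃) :
    foxThreeLin f z = (f z + f (s * z) - f (t * (s * z)) - f (s * (t * (s * z))),
      f (t * (s * z)) - f (t * z)) := rfl

/-- Summation of the values, as a morphism of representations. -/
noncomputable def augmentation : Rep.functions ℤ S₃ ℤ ⟶ Rep.trivial ℤ S₃ ℤ :=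
  Rep.ofHom <| LinearMap.intertwiningMap_of_isIntertwiningMap _ _
    { toFun := fun f => ∑ z, f z
      map_add' := fun _ _ => Finset.sum_add_distrib
      map_smul' := fun _ _ => (Finset.mul_sum _ _ _).symm }
    fun g _ => Fintype.sum_equiv (Equiv.mulRight g) _ _ fun _ => rfl

/-- `foxOneLin` as a morphism of representations. -/
noncomputable def foxOne : Rep.functions ℤ S₃ (ℤ × ℤ) ⟶ Rep.functions ℤ S₃ ℤ :=
  Rep.functionsHom foxOneLin fun g f x => by simp [foxOneLin_apply, mul_assoc]

/-- `foxTwoLin` as a morphism of representations. -/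
noncomputable def foxTwo : Rep.functions ℤ S₃ (ℤ × ℤ) ⟶ Rep.functions ℤ S₃ (ℤ × ℤ) :=
  Rep.functionsHom foxTwoLin fun g f x => by simp [foxTwoLin_apply, mul_assoc]

/-- `foxThreeLin` as a morphism of representations. -/
noncomputable def foxThree : Rep.functions ℤ S₃ ℤ ⟶ Rep.functions ℤ S₃ (ℤ × ℤ) :=
  Rep.functionsHom foxThreeLin fun g f x => by simp [foxThreeLin_apply, mul_assoc]

/-- The inclusion of the constant functions. -/
noncomputable def const : Rep.trivial ℤ S₃ ℤ ⟶ Rep.functions ℤ S₃ ℤ :=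
  Rep.ofHom <| LinearMap.intertwiningMap_of_isIntertwiningMap _ _
    { toFun := fun a _ => a
      map_add' := fun _ _ => rfl
      map_smul' := fun _ _ => rfl }
    fun _ _ => rfl

theorem foxOne_comp_augmentation : foxOne ≫ augmentation = 0 := by
  refine Rep.hom_ext (DFunLike.ext _ _ fun (f : S₃ → ℤ × ℤ) => ?_)
  change ∑ z, foxOneLin f z = 0
  simp only [sum_perm, foxOneLin_apply, mul_one, s_mul_s, t_mul_t, s_mul_s_mul_t,
    s_mul_t_mul_s, s_mul_s_mul_t_mul_s, t_mul_s_mul_t, t_mul_t_mul_s, t_mul_s_mul_t_mul_s]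
  ring

theorem foxTwo_comp_foxOne : foxTwo ≫ foxOne = 0 := by
  refine Rep.hom_ext (DFunLike.ext _ _ fun (f : S₃ → ℤ × ℤ) => funext ?_)
  change ∀ z, foxOneLin (foxTwoLin f) z = 0
  simp only [forall_perm_iff, foxOneLin_apply, foxTwoLin_apply, mul_one, s_mul_s, t_mul_t,
    s_mul_s_mul_t, s_mul_t_mul_s, s_mul_s_mul_t_mul_s, t_mul_s_mul_t, t_mul_t_mul_s,
    t_mul_s_mul_t_mul_s]
  refine ⟨?_, ?_, ?_, ?_, ?_, ?_⟩ <;> ring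

theorem foxThree_comp_foxTwo : foxThree ≫ foxTwo = 0 := by
  refine Rep.hom_ext (DFunLike.ext _ _ fun (f : S₃ → ℤ) => funext ?_)
  change ∀ z, foxTwoLin (foxThreeLin f) z = (0, 0)
  simp only [forall_perm_iff, foxTwoLin_apply, foxThreeLin_apply, Prod.mk.injEq, mul_one, s_mul_s,
    t_mul_t, s_mul_s_mul_t, s_mul_t_mul_s, s_mul_s_mul_t_mul_s, t_mul_s_mul_t, t_mul_t_mul_s,
    t_mul_s_mul_t_mul_s]
  refine ⟨⟨?_, ?_⟩, ⟨?_, ?_⟩, ⟨?_, ?_⟩, ⟨?_, ?_⟩, ⟨?_, ?_⟩, ?_, ?_⟩ <;> ring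

theorem const_comp_foxThree : const ≫ foxThree = 0 := by
  refine Rep.hom_ext (DFunLike.ext _ _ fun (a : ℤ) => funext fun z => ?_)
  change foxThreeLin (fun _ => a) z = (0, 0)
  simp [foxThreeLin_apply]

theorem exact_foxOne_augmentation :
    (ShortComplex.mk _ _ foxOne_comp_augmentation).Exact := by
  refine Rep.exact_of_forall _ fun (f : S₃ → ℤ) (hf : ∑ z, f z = 0) => ?_
  rw [sum_perm] at hf
  obtain ⟨F, h1, h2, h3, h4, h5, h6⟩ := exists_fun (V := ℤ × ℤ) (0, 0)
    (f 1 + f t, -f 1 - f s - f t) (0, -f t) (0, 0) (0, 0)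
    (-f (s * t) - f (s * t * s), f (s * t))
  refine ⟨F, funext ?_⟩
  change ∀ z, foxOneLin F z = f z
  simp only [forall_perm_iff, foxOneLin_apply, mul_one, s_mul_s, t_mul_t, s_mul_s_mul_t,
    s_mul_t_mul_s, s_mul_s_mul_t_mul_s, t_mul_s_mul_t, t_mul_t_mul_s, t_mul_s_mul_t_mul_s,
    h1, h2, h3, h4, h5, h6]
  refine ⟨?_, ?_, ?_, ?_, ?_, ?_⟩ <;> linarith

theorem exact_foxTwo_foxOne : (ShortComplex.mk _ _ foxTwo_comp_foxOne).Exact := by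
  refine Rep.exact_of_forall _ fun (f : S₃ → ℤ × ℤ) (hf : foxOneLin f = (0 : S₃ → ℤ)) => ?_
  replace hf : ∀ z, foxOneLin f z = 0 := fun z => congr_fun hf z
  simp only [forall_perm_iff, foxOneLin_apply, mul_one, s_mul_s, t_mul_t, s_mul_s_mul_t,
    s_mul_t_mul_s, s_mul_s_mul_t_mul_s, t_mul_s_mul_t, t_mul_t_mul_s, t_mul_s_mul_t_mul_s] at hf
  obtain ⟨e1, e2, e3, e4, e5, e6⟩ := hf
  obtain ⟨F, h1, h2, h3, h4, h5, h6⟩ := exists_fun (V := ℤ × ℤ)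
    (-(f (s * t)).2, 0) (-(f (t * s)).2 - (f (s * t * s)).2, (f s).1 + (f (s * t * s)).2)
    (0, (f (s * t)).1 + (f (t * s)).2) (0, 0) (-(f t).2 - (f (t * s)).2, 0)
    (-(f t).2, (f (s * t * s)).1 + (f t).2)
  refine ⟨F, funext ?_⟩
  change ∀ z, foxTwoLin F z = f z
  simp only [forall_perm_iff, foxTwoLin_apply, Prod.ext_iff, mul_one, s_mul_s, t_mul_t, s_mul_s_mul_t,
    s_mul_t_mul_s, s_mul_s_mul_t_mul_s, t_mul_s_mul_t, t_mul_t_mul_s, t_mul_s_mul_t_mul_s,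
    h1, h2, h3, h4, h5, h6]
  refine ⟨⟨?_, ?_⟩, ⟨?_, ?_⟩, ⟨?_, ?_⟩, ⟨?_, ?_⟩, ⟨?_, ?_⟩, ?_, ?_⟩ <;> linarith

theorem exact_foxThree_foxTwo : (ShortComplex.mk _ _ foxThree_comp_foxTwo).Exact := by
  refine Rep.exact_of_forall _ fun (f : S₃ → ℤ × ℤ) (hf : foxTwoLin f = (0 : S₃ → ℤ × ℤ)) => ?_
  replace hf : ∀ z, foxTwoLin f z = (0, 0) := fun z => congr_fun hf z
  simp only [forall_perm_iff, foxTwoLin_apply, Prod.mk.injEq, mul_one, s_mul_s, t_mul_t, s_mul_s_mul_t,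
    s_mul_t_mul_s, s_mul_s_mul_t_mul_s, t_mul_s_mul_t, t_mul_t_mul_s, t_mul_s_mul_t_mul_s] at hf
  obtain ⟨⟨a1, b1⟩, ⟨a2, b2⟩, ⟨a3, b3⟩, ⟨a4, b4⟩, ⟨a5, b5⟩, a6, b6⟩ := hf
  obtain ⟨F, h1, h2, h3, h4, h5, h6⟩ := exists_fun (V := ℤ)
    (f (s * t)).2 (-(f (t * s)).1 + (f 1).2 + (f (s * t * s)).2)
    ((f (s * t)).1 + (f (s * t)).2 + (f (s * t * s)).2) (-(f (t * s)).1 + (f 1).2)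
    ((f (s * t)).1 + (f 1).2 + (f (s * t)).2 + (f (s * t * s)).2) 0
  refine ⟨F, funext ?_⟩
  change ∀ z, foxThreeLin F z = f z
  simp only [forall_perm_iff, foxThreeLin_apply, Prod.ext_iff, mul_one, s_mul_s, t_mul_t,
    s_mul_s_mul_t, s_mul_t_mul_s, s_mul_s_mul_t_mul_s, t_mul_s_mul_t, t_mul_t_mul_s,
    t_mul_s_mul_t_mul_s, h1, h2, h3, h4, h5, h6]
  refine ⟨⟨?_, ?_⟩, ⟨?_, ?_⟩, ⟨?_, ?_⟩, ⟨?_, ?_⟩, ⟨?_, ?_⟩, ?_, ?_⟩ <;> linarith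

theorem exact_const_foxThree : (ShortComplex.mk _ _ const_comp_foxThree).Exact := by
  refine Rep.exact_of_forall _ fun (f : S₃ → ℤ) (hf : foxThreeLin f = (0 : S₃ → ℤ × ℤ)) => ?_
  replace hf : ∀ z, foxThreeLin f z = (0, 0) := fun z => congr_fun hf z
  simp only [forall_perm_iff, foxThreeLin_apply, Prod.mk.injEq, mul_one, s_mul_s, t_mul_t,
    s_mul_s_mul_t, s_mul_t_mul_s, s_mul_s_mul_t_mul_s, t_mul_s_mul_t, t_mul_t_mul_s,
    t_mul_s_mul_t_mul_s] at hf
  obtain ⟨⟨a1, b1⟩, ⟨a2, b2⟩, ⟨a3, b3⟩, ⟨a4, b4⟩, ⟨a5, b5⟩, a6, b6⟩ := hf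
  refine ⟨f 1, funext ?_⟩
  change ∀ z, f 1 = f z
  rw [forall_perm_iff]
  refine ⟨?_, ?_, ?_, ?_, ?_, ?_⟩ <;> linarith

instance : Mono const :=
  (Rep.mono_iff_injective _).2 fun (a b : ℤ) h => congr_fun (h : (fun _ : S₃ => a) = fun _ => b) 1

theorem augmentation_surjective : Function.Surjective augmentation.hom := by
  intro (a : ℤ)
  refine ⟨Pi.single 1 a, ?_⟩
  change ∑ z, (Pi.single 1 a : S₃ → ℤ) z = a
  simp

theorem shortExact_kernel_augmentation :
    (ShortComplex.mk (kernel.ι augmentation) augmentation (kernel.condition _)).ShortExact where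
  exact := ShortComplex.exact_kernel _
  mono_f := inferInstance
  epi_g := (Rep.epi_iff_surjective _).2 augmentation_surjective

theorem shortExact_kernel_foxOne :
    (ShortComplex.mk (kernel.ι foxOne) (kernel.lift _ _ foxOne_comp_augmentation)
      (by simp [← cancel_mono (kernel.ι augmentation)])).ShortExact :=
  ShortComplex.shortExact_kernelLift _ _ _ (kernel.condition _) _ (ShortComplex.exact_kernel _)
    exact_foxOne_augmentation

theorem shortExact_kernel_foxTwo :
    (ShortComplex.mk (kernel.ι foxTwo) (kernel.lift _ _ foxTwo_comp_foxOne)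
      (by simp [← cancel_mono (kernel.ι foxOne)])).ShortExact :=
  ShortComplex.shortExact_kernelLift _ _ _ (kernel.condition _) _ (ShortComplex.exact_kernel _)
    exact_foxTwo_foxOne

theorem shortExact_const :
    (ShortComplex.mk const (kernel.lift _ _ foxThree_comp_foxTwo)
      (by simp [← cancel_mono (kernel.ι foxTwo), const_comp_foxThree])).ShortExact :=
  ShortComplex.shortExact_kernelLift _ _ _ const_comp_foxThree _ exact_const_foxThree
    exact_foxThree_foxTwo

theorem nonempty_iso_kernel_augmentation (n : ℕ) :
    Nonempty (groupCohomology (kernel augmentation) (n + 1) ≅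
      groupCohomology (Rep.trivial ℤ S₃ ℤ) (n + 4)) := by
  obtain ⟨e₁⟩ := groupCohomology.nonempty_iso_succ shortExact_kernel_foxOne
    (Rep.isZero_groupCohomology_functions _ _ _) n
  obtain ⟨e₂⟩ := groupCohomology.nonempty_iso_succ shortExact_kernel_foxTwo
    (Rep.isZero_groupCohomology_functions _ _ _) (n + 1)
  obtain ⟨e₃⟩ := groupCohomology.nonempty_iso_succ shortExact_const
    (Rep.isZero_groupCohomology_functions _ _ _) (n + 2)
  exact ⟨e₁ ≪≫ e₂ ≪≫ e₃⟩

theorem nonempty_iso_add_four (n : ℕ) :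
    Nonempty (groupCohomology (Rep.trivial ℤ S₃ ℤ) (n + 1) ≅
      groupCohomology (Rep.trivial ℤ S₃ ℤ) (n + 5)) := by
  obtain ⟨e₀⟩ := groupCohomology.nonempty_iso_succ shortExact_kernel_augmentation
    (Rep.isZero_groupCohomology_functions _ _ _) n
  obtain ⟨e₁⟩ := nonempty_iso_kernel_augmentation (n + 1)
  exact ⟨e₀ ≪≫ e₁⟩

theorem nonempty_kernel_augmentation_one_addEquiv :
    Nonempty (groupCohomology (kernel augmentation) 1 ≃+ ZMod 6) := by
  obtain ⟨φ, hφ, hker⟩ := groupCohomology.exists_surjective_invariants_to_one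
    shortExact_kernel_augmentation (Rep.isZero_groupCohomology_functions _ _ _ 0)
  let ι : ℤ →+ (Rep.trivial ℤ S₃ ℤ).ρ.invariants :=
    { toFun := fun a => ⟨a, fun _ => rfl⟩
      map_zero' := rfl
      map_add' := fun _ _ => rfl }
  let ψ : ℤ →+ groupCohomology (kernel augmentation) 1 := φ.toAddMonoidHom.comp ι
  have hψ : Function.Surjective ψ := hφ.comp fun x => ⟨x.1, rfl⟩
  have hψker : ψ.ker = AddSubgroup.zmultiples (6 : ℤ) := by
    ext a
    rw [AddMonoidHom.mem_ker, Int.mem_zmultiples_iff]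
    refine (hker (ι a)).trans ⟨?_, ?_⟩
    · rintro ⟨⟨(y : S₃ → ℤ), hy⟩, (hya : ∑ z, y z = a)⟩
      have hconst : ∀ z, y z = y 1 := fun z => by
        simpa using congr_fun (hy z : (fun x => y (x * z)) = y) 1
      refine ⟨y 1, ?_⟩
      rw [← hya, sum_perm, hconst s, hconst t, hconst (s * t), hconst (t * s), hconst (s * t * s)]
      ring
    · rintro ⟨b, rfl⟩
      refine ⟨⟨fun _ => b, fun _ => rfl⟩, ?_⟩
      change ∑ _z : S₃, b = 6 * b
      rw [sum_perm]
      ring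
  exact ⟨(QuotientAddGroup.quotientKerEquivOfSurjective ψ hψ).symm.trans
    ((QuotientAddGroup.quotientAddEquivOfEq hψker).trans (Int.quotientZMultiplesNatEquivZMod 6))⟩

end SymmetricGroupThree

/-- For every positive natural number `n ≡ 0 (mod 4)`, the group cohomology `H^n(Σ₃; ℤ)`
(with trivial action on `ℤ`) is isomorphic to `ℤ/6ℤ`. -/
theorem groupCohomology_sigma3_zero_mod_four (n : ℕ) (hn : n % 4 = 0) (hpos : 0 < n) :
    Nonempty ((groupCohomology (Rep.trivial ℤ (Equiv.Perm (Fin 3)) ℤ) n) ≃+ ZMod 6) := by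
  obtain ⟨m, rfl⟩ : ∃ m, n = 4 * m + 4 := ⟨n / 4 - 1, by lia⟩
  clear hn hpos
  induction m with
  | zero =>
    obtain ⟨e⟩ := SymmetricGroupThree.nonempty_iso_kernel_augmentation 0
    obtain ⟨f⟩ := SymmetricGroupThree.nonempty_kernel_augmentation_one_addEquiv
    exact ⟨e.toLinearEquiv.toAddEquiv.symm.trans f⟩
  | succ m ih =>
    obtain ⟨e⟩ := SymmetricGroupThree.nonempty_iso_add_four (4 * m + 3)
    obtain ⟨f⟩ := ih
    exact ⟨e.toLinearEquiv.toAddEquiv.symm.trans f⟩
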